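/- Let U ⊆ ℝ^{2n} be open, let B : U → M_{2n}(ℝ) be a real analytic structure matrix with B(z) invertible for all z ∈ U, let H : U → ℝ and c : U → ℝ^{2n} be real analytic with B(z)^{-1} = Dc(z)^T − Dc(z) for all z ∈ U, where (Dc(z))_{ij} = ∂c_i/∂z_j. Let γ > 0, σ > 0, let ω ∈ ℝ^n be (γ,σ)-Diophantine, and let K : ℝ^n → U be real analytic, ℤ^n-periodic, with ∂_ω K(θ) = B(K(θ))∇H(K(θ)) for all θ. Then there exist a real analytic ℤ^n-periodic function b : ℝ^n → ℝ and a constant vector a₀ ∈ ℝ^n such that DK(θ)^T c(K(θ)) = ∇b(θ) + a₀ for all θ ∈ ℝ^n; that is, the pull-back under K of the 1-form c·dz equals db + a₀·dθ. -/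

import Mathlib

open Matrix

/-- The gradient of `H : ℝ^d → ℝ`, with entries `∂H/∂z_i`. -/
noncomputable def pgrad {d : ℕ} (H : (Fin d → ℝ) → ℝ) (z : Fin d → ℝ) : Fin d → ℝ :=
  fun i => fderiv ℝ H z (Pi.single i 1)

/-- The Jacobian matrix of `f : ℝ^a → ℝ^b`, with entries `∂f_i/∂z_j`. -/
noncomputable def pjac {a b : ℕ} (f : (Fin a → ℝ) → (Fin b → ℝ)) (z : Fin a → ℝ) :
    Matrix (Fin b) (Fin a) ℝ :=
  Matrix.of fun i j => fderiv ℝ f z (Pi.single j 1) i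

/-- `ω ∈ ℝⁿ` is `(γ, σ)`-Diophantine. -/
def IsDiophantine {n : ℕ} (γ σ : ℝ) (ω : Fin n → ℝ) : Prop :=
  ∀ k : Fin n → ℤ, k ≠ 0 →
    γ * (∑ i, |(k i : ℝ)|) ^ (-σ) ≤ |∑ i, (k i : ℝ) * ω i|

section Primitive

variable {E F : Type*} [NormedAddCommGroup E] [NormedSpace ℝ E]
  [NormedAddCommGroup F] [NormedSpace ℝ F]

/-- Term-by-term integration of a power series along rays. -/
theorem HasFPowerSeriesOnBall.hasSum_integral_ray [CompleteSpace F] {f : E → E →L[ℝ] F}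
    {p : FormalMultilinearSeries ℝ E (E →L[ℝ] F)} {x : E} {r : ENNReal}
    (hf : HasFPowerSeriesOnBall f p x r) {y : E} (hy : y ∈ Metric.eball (0 : E) r) :
    HasSum (fun m : ℕ => ((m : ℝ) + 1)⁻¹ • p m (fun _ => y) y)
      (∫ t in (0 : ℝ)..1, f (x + t • y) y) := by
  have hsum : Summable fun m : ℕ => ‖p m fun _ => y‖ * ‖y‖ :=
    (p.summable_norm_apply (Metric.eball_subset_eball hf.r_le hy)).mul_right _
  have key := intervalIntegral.hasSum_integral_of_dominated_convergence
    (μ := MeasureTheory.volume) (a := (0 : ℝ)) (b := 1)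
    (F := fun (m : ℕ) (t : ℝ) => t ^ m • p m (fun _ => y) y)
    (f := fun t => f (x + t • y) y)
    (fun m _ => ‖p m fun _ => y‖ * ‖y‖)
    (fun m => by
      have : Continuous fun t : ℝ => t ^ m • p m (fun _ => y) y := by fun_prop
      exact this.aestronglyMeasurable)
    (fun m => Filter.Eventually.of_forall fun t ht => by
      rw [Set.uIoc_of_le zero_le_one] at ht
      rw [norm_smul, norm_pow, Real.norm_of_nonneg ht.1.le]
      exact (mul_le_of_le_one_left (norm_nonneg _) (pow_le_one₀ ht.1.le ht.2)).trans
        ((p m fun _ => y).le_opNorm y))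
    (Filter.Eventually.of_forall fun t _ => hsum)
    (intervalIntegrable_const)
    (Filter.Eventually.of_forall fun t ht => by
      rw [Set.uIoc_of_le zero_le_one] at ht
      have hty : t • y ∈ Metric.eball (0 : E) r := by
        rw [mem_eball_zero_iff] at hy ⊢
        refine lt_of_le_of_lt ?_ hy
        rw [← ofReal_norm, ← ofReal_norm, norm_smul, Real.norm_of_nonneg ht.1.le]
        exact ENNReal.ofReal_le_ofReal (mul_le_of_le_one_left (norm_nonneg _) ht.2)
      have := (ContinuousLinearMap.apply ℝ F y).hasSum (hf.hasSum hty)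
      refine this.congr_fun fun m => ?_
      have := (p m).map_smul_univ (fun _ => t) (fun _ => y)
      simp only [Finset.prod_const, Finset.card_univ, Fintype.card_fin] at this
      simp [this])
  refine key.congr_fun fun m => ?_
  simp [intervalIntegral.integral_smul_const, integral_pow]

/-- A primitive of an analytic family of linear maps is analytic. -/
theorem AnalyticAt.of_hasFDerivAt [CompleteSpace F] {b : E → F} {f : E → E →L[ℝ] F}
    (hb : ∀ x, HasFDerivAt b (f x) x) (hc : Continuous f) {x : E} (hf : AnalyticAt ℝ f x) :
    AnalyticAt ℝ b x := by
  obtain ⟨p, r, hp⟩ := hf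
  let q : FormalMultilinearSeries ℝ E (E →L[ℝ] F) := fun m => ((m : ℝ) + 1)⁻¹ • p m
  have hq : p.radius ≤ q.radius := by
    refine ENNReal.le_of_forall_nnreal_lt fun s hs => ?_
    obtain ⟨C, -, hC⟩ := p.norm_mul_pow_le_of_lt_radius hs
    refine q.le_radius_of_bound C fun m => le_trans ?_ (hC m)
    gcongr
    simp only [q, norm_smul]
    refine mul_le_of_le_one_left (norm_nonneg _) ?_
    rw [Real.norm_of_nonneg (by positivity)]
    exact inv_le_one_of_one_le₀ (by simp)
  refine ⟨q.unshift (b x), r, ⟨?_, hp.r_pos, fun {y} hy => ?_⟩⟩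
  · rw [FormalMultilinearSeries.radius_unshift]
    exact hp.r_le.trans hq
  · have hint : ∫ t in (0 : ℝ)..1, f (x + t • y) y = b (x + y) - b x := by
      have := intervalIntegral.integral_eq_sub_of_hasDerivAt (a := (0 : ℝ)) (b := 1)
        (f := fun t : ℝ => b (x + t • y)) (f' := fun t => f (x + t • y) y)
        (fun t _ => by
          have hl : HasDerivAt (fun t : ℝ => x + t • y) y t := by
            simpa using ((hasDerivAt_id t).smul_const y).const_add x
          exact (hb (x + t • y)).comp_hasDerivAt t hl)
        (Continuous.intervalIntegrable (by fun_prop) _ _)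
      simpa using this
    have hs := hp.hasSum_integral_ray hy
    rw [hint] at hs
    rw [← hasSum_nat_add_iff' 1]
    simpa [FormalMultilinearSeries.unshift, q, Fin.init_def] using hs

end Primitive

section Ergodic

/-- A continuous periodic function invariant under a nonresonant linear flow is constant. -/
theorem eq_of_periodic_of_invariant_of_nonresonant {n : ℕ} {g : (Fin n → ℝ) → ℝ}
    (hg : Continuous g)
    (hper : ∀ (θ : Fin n → ℝ) (k : Fin n → ℤ), g (θ + fun i => (k i : ℝ)) = g θ)
    {ω : Fin n → ℝ} (hω : ∀ k : Fin n → ℤ, k ≠ 0 → ∑ i, (k i : ℝ) * ω i ≠ 0)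
    (hinv : ∀ (θ : Fin n → ℝ) (t : ℝ), g (θ + t • ω) = g θ) (x y : Fin n → ℝ) : g x = g y := by
  have hmap : IsOpenQuotientMap (Pi.map fun (_ : Fin n) (s : ℝ) => (s : UnitAddCircle)) :=
    IsOpenQuotientMap.piMap fun _ => QuotientAddGroup.isOpenQuotientMap_mk
  let π : C(Fin n → ℝ, UnitAddTorus (Fin n)) := ⟨_, hmap.continuous⟩
  have hπ : IsOpenQuotientMap π := hmap
  let g₀ : C(Fin n → ℝ, ℂ) := ⟨fun θ => (g θ : ℂ), by fun_prop⟩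
  have hfac : Function.FactorsThrough g₀ π := by
    intro a b hab
    have h : ∀ i, ∃ k : ℤ, b i + k = a i := fun i => by
      have hi : ((a i - b i : ℝ) : UnitAddCircle) = 0 := by
        rw [AddCircle.coe_sub, sub_eq_zero]
        exact congrFun hab i
      obtain ⟨k, hk⟩ := (AddCircle.coe_eq_zero_iff 1).1 hi
      refine ⟨k, ?_⟩
      simp at hk
      linarith
    choose k hk using h
    have : a = b + fun i => (k i : ℝ) := funext fun i => (hk i).symm
    simp [g₀, this, hper]
  let G : C(UnitAddTorus (Fin n), ℂ) := hπ.isQuotientMap.lift g₀ hfac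
  have hG : ∀ θ, G (π θ) = g θ := fun θ =>
    congrArg (fun f : C(Fin n → ℝ, ℂ) => f θ) (hπ.isQuotientMap.lift_comp g₀ hfac)
  have hadd : ∀ a b, π (a + b) = π a + π b := fun a b => by
    ext i; simp [π]
  have hGinv : ∀ t z, G (z + π (t • ω)) = G z := fun t z => by
    obtain ⟨θ, rfl⟩ := hπ.surjective z
    rw [← hadd, hG, hG, hinv]
  have hF : ∀ (k : Fin n → ℤ) (z w : UnitAddTorus (Fin n)),
      UnitAddTorus.mFourier k (z + w) = UnitAddTorus.mFourier k z * UnitAddTorus.mFourier k w := by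
    intro k z w
    simp [UnitAddTorus.mFourier, fourier_apply, smul_add, AddCircle.toCircle_add,
      Finset.prod_mul_distrib]
  have hcoeff : ∀ k : Fin n → ℤ, k ≠ 0 → UnitAddTorus.mFourierCoeff G k = 0 := by
    intro k hk
    have hS := hω k hk
    set S := ∑ i, (k i : ℝ) * ω i with hSdef
    let t : ℝ := 1 / (2 * S)
    have hval : UnitAddTorus.mFourier (-k) (π (t • ω)) = -1 := by
      have hexp : UnitAddTorus.mFourier (-k) (π (t • ω))
          = Complex.exp (∑ i, 2 * Real.pi * Complex.I * ((-k i : ℤ) : ℂ) * ((t * ω i : ℝ) : ℂ)) := by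
        rw [Complex.exp_sum]
        simp only [UnitAddTorus.mFourier, ContinuousMap.coe_mk]
        refine Finset.prod_congr rfl fun i _ => ?_
        have : π (t • ω) i = ((t * ω i : ℝ) : UnitAddCircle) := rfl
        rw [this, fourier_coe_apply]
        simp
      have harg : ∑ i, 2 * Real.pi * Complex.I * ((-k i : ℤ) : ℂ) * ((t * ω i : ℝ) : ℂ)
          = -(Real.pi * Complex.I) := by
        have h1 : ∑ i, 2 * Real.pi * Complex.I * ((-k i : ℤ) : ℂ) * ((t * ω i : ℝ) : ℂ)
            = -(2 * Real.pi * Complex.I * ((t * S : ℝ) : ℂ)) := by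
          rw [hSdef]
          push_cast
          rw [Finset.mul_sum, Finset.mul_sum, ← Finset.sum_neg_distrib]
          exact Finset.sum_congr rfl fun i _ => by ring
        have h2 : t * S = 1 / 2 := by
          simp only [t]; field_simp
        rw [h1, h2]
        push_cast
        ring
      rw [hexp, harg, Complex.exp_neg, Complex.exp_pi_mul_I]
      norm_num
    let μ : MeasureTheory.Measure (UnitAddTorus (Fin n)) :=
      MeasureTheory.Measure.pi fun _ => AddCircle.haarAddCircle
    have hI : UnitAddTorus.mFourierCoeff G k = -UnitAddTorus.mFourierCoeff G k := by
      calc UnitAddTorus.mFourierCoeff G k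
          = ∫ z, UnitAddTorus.mFourier (-k) (z + π (t • ω)) • G (z + π (t • ω)) ∂μ :=
            (MeasureTheory.integral_add_right_eq_self (μ := μ)
              (fun z => UnitAddTorus.mFourier (-k) z • G z) (π (t • ω))).symm
        _ = ∫ z, -(UnitAddTorus.mFourier (-k) z • G z) ∂μ := by
            congr 1; ext z; rw [hF, hval, hGinv]; simp
        _ = _ := by rw [MeasureTheory.integral_neg]; rfl
    exact self_eq_neg.1 hI
  have hsum : ∀ z, G z = UnitAddTorus.mFourierCoeff G 0 := fun z => by
    have hs : Summable (UnitAddTorus.mFourierCoeff G) :=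
      summable_of_ne_finset_zero (s := {0}) fun k hk => hcoeff k (by simpa using hk)
    have h1 := UnitAddTorus.hasSum_mFourier_series_apply_of_summable hs z
    have h2 := hasSum_single (f := fun k => UnitAddTorus.mFourierCoeff G k •
      UnitAddTorus.mFourier k z) 0 fun k hk => by simp [hcoeff k hk]
    rw [h1.unique h2]
    simp [UnitAddTorus.mFourier_zero]
  have : (g x : ℂ) = g y := by rw [← hG, ← hG, hsum, hsum]
  exact_mod_cast this

end Ergodic

section Closed

/-- If the exterior derivative of a one-form is constant on a pair of periods of the form,
then it vanishes on that pair. -/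
theorem eq_zero_of_fderiv_sub_fderiv_eq_const {E : Type*} [NormedAddCommGroup E]
    [NormedSpace ℝ E] {α : E → E →L[ℝ] ℝ} (hα : Differentiable ℝ α) {u v : E}
    (hu : ∀ θ, α (θ + u) = α θ) (hv : ∀ θ, α (θ + v) = α θ) {l : ℝ}
    (hl : ∀ θ, fderiv ℝ α θ u v - fderiv ℝ α θ v u = l) : l = 0 := by
  let L : ℝ × ℝ →L[ℝ] E :=
    (ContinuousLinearMap.fst ℝ ℝ ℝ).smulRight u + (ContinuousLinearMap.snd ℝ ℝ ℝ).smulRight v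
  have hd : ∀ (w : E) (x : ℝ × ℝ), HasFDerivAt (fun x => α (L x) w)
      ((ContinuousLinearMap.apply ℝ ℝ w) ∘L (fderiv ℝ α (L x)) ∘L L) x := fun w x =>
    (ContinuousLinearMap.apply ℝ ℝ w).hasFDerivAt.comp x
      ((hα (L x)).hasFDerivAt.comp x L.hasFDerivAt)
  have hcont : ∀ w : E, Continuous fun x => α (L x) w := fun w =>
    continuous_iff_continuousAt.2 fun x => (hd w x).continuousAt
  have hval : ∀ x : ℝ × ℝ,
      ((ContinuousLinearMap.apply ℝ ℝ v) ∘L (fderiv ℝ α (L x)) ∘L L) (1, 0)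
        + (-((ContinuousLinearMap.apply ℝ ℝ u) ∘L (fderiv ℝ α (L x)) ∘L L)) (0, 1) = l := by
    intro x
    rw [← hl (L x)]
    simp [L, sub_eq_add_neg]
  have key := MeasureTheory.integral2_divergence_prod_of_hasFDerivAt
    (fun x : ℝ × ℝ => α (L x) v) (fun x => -α (L x) u)
    (fun x => (ContinuousLinearMap.apply ℝ ℝ v) ∘L (fderiv ℝ α (L x)) ∘L L)
    (fun x => -((ContinuousLinearMap.apply ℝ ℝ u) ∘L (fderiv ℝ α (L x)) ∘L L)) 0 0 1 1
    (hcont v).continuousOn (hcont u).neg.continuousOn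
    (fun x _ => hd v x) (fun x _ => (hd u x).neg)
    (by
      simp only [hval]
      exact (continuous_const.continuousOn).integrableOn_compact
        (isCompact_uIcc.prod isCompact_uIcc))
  simp only [hval] at key
  have h1 : ∀ t : ℝ, α (L (1, t)) = α (L (0, t)) := fun t => by
    rw [← hu (L (0, t))]; simp [L, add_comm]
  have h2 : ∀ s : ℝ, α (L (s, 1)) = α (L (s, 0)) := fun s => by
    rw [← hv (L (s, 0))]; simp [L]
  simpa [h1, h2] using key

/-- A periodic one-form whose derivative along a nonresonant direction is exact is closed. -/
theorem fderiv_symm_of_fderiv_apply_eq_fderiv {n : ℕ} {α : (Fin n → ℝ) → (Fin n → ℝ) →L[ℝ] ℝ}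
    (hα : ContDiff ℝ 2 α) (hper : ∀ (θ : Fin n → ℝ) (k : Fin n → ℤ),
      α (θ + fun i => (k i : ℝ)) = α θ)
    {ω : Fin n → ℝ} (hω : ∀ k : Fin n → ℤ, k ≠ 0 → ∑ i, (k i : ℝ) * ω i ≠ 0)
    {f : (Fin n → ℝ) → ℝ} (hf : ContDiff ℝ 2 f) (h : ∀ θ, fderiv ℝ α θ ω = fderiv ℝ f θ)
    (θ u v : Fin n → ℝ) : fderiv ℝ α θ u v = fderiv ℝ α θ v u := by
  have hα1 : ContDiff ℝ 1 (fderiv ℝ α) := hα.fderiv_right (by norm_num)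
  have hDα : Differentiable ℝ (fderiv ℝ α) := hα1.differentiable one_ne_zero
  have hperD : ∀ (θ : Fin n → ℝ) (k : Fin n → ℤ),
      fderiv ℝ α (θ + fun i => (k i : ℝ)) = fderiv ℝ α θ := fun θ k => by
    rw [← fderiv_comp_add_right]
    simp only [hper]
  have hflow : ∀ θ u v, fderiv ℝ (fderiv ℝ α) θ ω u v = fderiv ℝ (fderiv ℝ f) θ u v := by
    intro θ u v
    have hs := (hα.contDiffAt (x := θ)).isSymmSndFDerivAt (by simp)
    rw [hs.eq ω u]
    have hd := (hDα θ).hasFDerivAt.clm_apply (hasFDerivAt_const ω θ)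
    simp only [h] at hd
    simp [hd.fderiv]
  have hconst : ∀ u v θ θ', fderiv ℝ α θ u v - fderiv ℝ α θ v u
      = fderiv ℝ α θ' u v - fderiv ℝ α θ' v u := by
    intro u v θ θ'
    refine eq_of_periodic_of_invariant_of_nonresonant
      (g := fun θ => fderiv ℝ α θ u v - fderiv ℝ α θ v u) ?_ ?_ hω ?_ θ θ'
    · have := hDα.continuous
      fun_prop
    · intro θ k
      simp only [hperD]
    · intro θ t
      have hder : ∀ s : ℝ, HasDerivAt (fun s : ℝ => fderiv ℝ α (θ + s • ω) u v
          - fderiv ℝ α (θ + s • ω) v u) 0 s := by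
        intro s
        have hl : HasDerivAt (fun s : ℝ => θ + s • ω) ω s := by
          simpa using ((hasDerivAt_id s).smul_const ω).const_add θ
        have hw : HasDerivAt (fun s : ℝ => fderiv ℝ α (θ + s • ω))
            (fderiv ℝ (fderiv ℝ α) (θ + s • ω) ω) s :=
          HasFDerivAt.comp_hasDerivAt (l := fderiv ℝ α) (f := fun s : ℝ => θ + s • ω) s
            (hDα (θ + s • ω)).hasFDerivAt hl
        have hsub := ((hw.clm_apply (hasDerivAt_const s u)).clm_apply (hasDerivAt_const s v)).sub
          ((hw.clm_apply (hasDerivAt_const s v)).clm_apply (hasDerivAt_const s u))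
        convert! hsub using 1
        have hs := (hf.contDiffAt (x := θ + s • ω)).isSymmSndFDerivAt (by simp)
        simp [hflow, hs.eq u v]
      have := is_const_of_deriv_eq_zero (fun s => (hder s).differentiableAt)
        (fun s => (hder s).deriv) t 0
      simpa using this
  have hbasis : ∀ i j : Fin n, fderiv ℝ α θ (Pi.single i 1) (Pi.single j 1)
      = fderiv ℝ α θ (Pi.single j 1) (Pi.single i 1) := by
    intro i j
    have hp : ∀ (i : Fin n) θ, α (θ + Pi.single i 1) = α θ := fun i θ => by
      rw [← hper θ (Pi.single i 1)]
      congr 2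
      ext m
      by_cases hm : m = i <;> simp [hm]
    exact sub_eq_zero.1 (eq_zero_of_fderiv_sub_fderiv_eq_const
      (hα.differentiable two_ne_zero) (hp i) (hp j)
      fun θ' => hconst (Pi.single i 1) (Pi.single j 1) θ' θ)
  have hflip : fderiv ℝ α θ = (fderiv ℝ α θ).flip := by
    refine ContinuousLinearMap.coe_injective ((Pi.basisFun ℝ (Fin n)).ext fun i => ?_)
    refine ContinuousLinearMap.coe_injective ((Pi.basisFun ℝ (Fin n)).ext fun j => ?_)
    simpa using hbasis i j
  exact congrArg (fun T => T u v) hflip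

/-- A closed periodic analytic one-form is the sum of the differential of a periodic analytic
function and a constant form. -/
theorem exists_analytic_periodic_primitive_add_const {n : ℕ}
    {α : (Fin n → ℝ) → (Fin n → ℝ) →L[ℝ] ℝ} (hα : ∀ θ, AnalyticAt ℝ α θ)
    (hper : ∀ (θ : Fin n → ℝ) (k : Fin n → ℤ), α (θ + fun i => (k i : ℝ)) = α θ)
    (hclosed : ∀ θ u v, fderiv ℝ α θ u v = fderiv ℝ α θ v u) :
    ∃ (b : (Fin n → ℝ) → ℝ) (a₀ : Fin n → ℝ), (∀ θ, AnalyticAt ℝ b θ) ∧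
      (∀ (θ : Fin n → ℝ) (k : Fin n → ℤ), b (θ + fun i => (k i : ℝ)) = b θ) ∧
      ∀ θ v, α θ v = fderiv ℝ b θ v + a₀ ⬝ᵥ v := by
  have hdiff : Differentiable ℝ α := fun θ => (hα θ).differentiableAt
  obtain ⟨P, hP⟩ := convex_univ.exists_forall_hasFDerivAt_of_fderiv_symmetric isOpen_univ
    hdiff.differentiableOn fun θ _ => hclosed θ
  replace hP : ∀ θ, HasFDerivAt P (α θ) θ := fun θ => hP θ (Set.mem_univ θ)
  have hinc : ∀ (k : Fin n → ℤ) (θ : Fin n → ℝ),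
      P (θ + fun i => (k i : ℝ)) = P θ + (P (fun i => (k i : ℝ)) - P 0) := by
    intro k θ
    have hd : ∀ θ : Fin n → ℝ,
        HasFDerivAt (fun θ => P (θ + fun i => (k i : ℝ)) - P θ) 0 θ := fun θ => by
      have h := ((hasFDerivAt_comp_add_right _).2 (hP (θ + fun i => (k i : ℝ)))).sub (hP θ)
      rwa [hper, sub_self] at h
    have := is_const_of_fderiv_eq_zero (𝕜 := ℝ) (fun θ => (hd θ).differentiableAt)
      (fun θ => (hd θ).fderiv) θ 0
    simp only [zero_add] at this
    linarith
  let φ : (Fin n → ℤ) →+ ℝ :=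
    { toFun := fun k => P (fun i => (k i : ℝ)) - P 0
      map_zero' := by
        have : (fun i : Fin n => (((0 : Fin n → ℤ) i : ℤ) : ℝ)) = 0 := by ext; simp
        rw [this, sub_self]
      map_add' := fun k m => by
        have h := hinc m fun i => (k i : ℝ)
        have : (fun i => (((k + m) i : ℤ) : ℝ)) = (fun i => (k i : ℝ)) + fun i => (m i : ℝ) := by
          ext; simp
        rw [this, h]
        ring }
  let a₀ : Fin n → ℝ := fun i => φ (Pi.single i 1)
  have hφ : ∀ k : Fin n → ℤ, φ k = a₀ ⬝ᵥ fun i => (k i : ℝ) := fun k => by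
    have := LinearMap.pi_apply_eq_sum_univ φ.toIntLinearMap k
    simp only [AddMonoidHom.coe_toIntLinearMap] at this
    rw [this, dotProduct]
    refine Finset.sum_congr rfl fun i _ => ?_
    have hs : (fun j => if i = j then (1 : ℤ) else 0) = Pi.single i 1 := by
      ext j; simp [Pi.single_apply, eq_comm]
    simp [a₀, hs, mul_comm]
  let ℓ : (Fin n → ℝ) →L[ℝ] ℝ := LinearMap.toContinuousLinearMap (dotProductBilin ℝ ℝ a₀)
  have hℓ : ∀ v, ℓ v = a₀ ⬝ᵥ v := fun v => rfl
  have hb : ∀ θ, HasFDerivAt (fun θ => P θ - ℓ θ) (α θ - ℓ) θ := fun θ =>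
    (hP θ).sub ℓ.hasFDerivAt
  refine ⟨fun θ => P θ - ℓ θ, a₀, fun θ => ?_, fun θ k => ?_, fun θ v => ?_⟩
  · exact AnalyticAt.of_hasFDerivAt hb (hdiff.continuous.sub continuous_const)
      ((hα θ).sub analyticAt_const)
  · have h := hφ k
    have h' : φ k = P (fun i => (k i : ℝ)) - P 0 := rfl
    simp only [hinc k θ, hℓ, dotProduct_add]
    linarith
  · rw [(hb θ).fderiv, ← hℓ]
    simp

end Closed

section Pullback

theorem pjac_mulVec {a b : ℕ} (f : (Fin a → ℝ) → (Fin b → ℝ)) (z v : Fin a → ℝ) :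
    (pjac f z).mulVec v = fderiv ℝ f z v := by
  have : (pjac f z).mulVecLin = (fderiv ℝ f z : (Fin a → ℝ) →ₗ[ℝ] (Fin b → ℝ)) := by
    refine (Pi.basisFun ℝ (Fin a)).ext fun j => ?_
    ext i
    simp [pjac]
  exact congrArg (fun T => T v) this

theorem pgrad_dotProduct {d : ℕ} (H : (Fin d → ℝ) → ℝ) (z v : Fin d → ℝ) :
    pgrad H z ⬝ᵥ v = fderiv ℝ H z v := by
  have : dotProductBilin ℝ ℝ (pgrad H z) = (fderiv ℝ H z : (Fin d → ℝ) →ₗ[ℝ] ℝ) :=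
    (Pi.basisFun ℝ (Fin d)).ext fun j => by simp [pgrad]
  exact congrArg (fun T => T v) this

theorem IsDiophantine.sum_mul_ne_zero {n : ℕ} {γ σ : ℝ} {ω : Fin n → ℝ}
    (hω : IsDiophantine γ σ ω) (hγ : 0 < γ) {k : Fin n → ℤ} (hk : k ≠ 0) :
    ∑ i, (k i : ℝ) * ω i ≠ 0 := by
  intro h0
  have h := hω k hk
  rw [h0, abs_zero] at h
  obtain ⟨i, hi⟩ := Function.ne_iff.1 hk
  have hS : 0 < ∑ i, |(k i : ℝ)| :=
    Finset.sum_pos' (fun _ _ => abs_nonneg _) ⟨i, Finset.mem_univ i, by simpa using hi⟩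
  exact absurd h (not_le.2 (by positivity))

/-- The pull-back of the one-form `c·dz` under `K`. -/
noncomputable def pullbackForm {n m : ℕ} (c : (Fin m → ℝ) → (Fin m → ℝ))
    (K : (Fin n → ℝ) → (Fin m → ℝ)) (θ : Fin n → ℝ) : (Fin n → ℝ) →L[ℝ] ℝ :=
  ∑ i, c (K θ) i • (ContinuousLinearMap.proj i ∘L fderiv ℝ K θ)

variable {n m : ℕ} {c : (Fin m → ℝ) → (Fin m → ℝ)} {K : (Fin n → ℝ) → (Fin m → ℝ)}

theorem pullbackForm_apply (θ v : Fin n → ℝ) :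
    pullbackForm c K θ v = c (K θ) ⬝ᵥ fderiv ℝ K θ v := by
  simp [pullbackForm, dotProduct]

theorem analyticAt_pullbackForm {θ : Fin n → ℝ} (hc : AnalyticAt ℝ c (K θ))
    (hK : AnalyticAt ℝ K θ) : AnalyticAt ℝ (pullbackForm c K) θ := by
  have hcK : AnalyticAt ℝ (fun θ => c (K θ)) θ := hc.comp hK
  have hcomp : ∀ i, AnalyticAt ℝ (fun θ => c (K θ) i) θ := fun i =>
    ((ContinuousLinearMap.proj (R := ℝ) (φ := fun _ : Fin m => ℝ) i).analyticAt _).comp hcK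
  have hform : ∀ i, AnalyticAt ℝ (fun θ =>
      (ContinuousLinearMap.proj (R := ℝ) (φ := fun _ : Fin m => ℝ) i) ∘L fderiv ℝ K θ) θ :=
    fun i => ((ContinuousLinearMap.compL ℝ (Fin n → ℝ) (Fin m → ℝ) ℝ
      (ContinuousLinearMap.proj i)).analyticAt _).comp hK.fderiv
  exact Finset.analyticAt_fun_sum _ fun i _ => (hcomp i).smul (hform i)

theorem fderiv_pullbackForm_apply {θ : Fin n → ℝ} (hc : AnalyticAt ℝ c (K θ))
    (hK : AnalyticAt ℝ K θ) (u v : Fin n → ℝ) :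
    fderiv ℝ (pullbackForm c K) θ u v
      = fderiv ℝ c (K θ) (fderiv ℝ K θ u) ⬝ᵥ fderiv ℝ K θ v
        + c (K θ) ⬝ᵥ fderiv ℝ (fderiv ℝ K) θ u v := by
  have h1 := ((analyticAt_pullbackForm hc hK).differentiableAt.hasFDerivAt).clm_apply
    (hasFDerivAt_const v θ)
  simp only [pullbackForm_apply, dotProduct] at h1
  have hcK : HasFDerivAt (fun θ => c (K θ)) (fderiv ℝ c (K θ) ∘L fderiv ℝ K θ) θ :=
    hc.differentiableAt.hasFDerivAt.comp θ hK.differentiableAt.hasFDerivAt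
  have hKv := (hK.fderiv.differentiableAt.hasFDerivAt).clm_apply (hasFDerivAt_const v θ)
  have h2 := HasFDerivAt.fun_sum (u := Finset.univ) fun i _ =>
    ((hasFDerivAt_pi'.1 hcK i).mul (hasFDerivAt_pi'.1 hKv i))
  have h3 := congrArg (fun T => T u) (h1.unique h2)
  simp only [ContinuousLinearMap.comp_zero, zero_add, ContinuousLinearMap.flip_apply] at h3
  rw [h3]
  simp [dotProduct, Finset.sum_add_distrib, mul_comm, add_comm]

/-- The exterior derivative of the pull-back of `c·dz`. -/
theorem fderiv_pullbackForm_sub {θ : Fin n → ℝ} (hc : AnalyticAt ℝ c (K θ))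
    (hK : AnalyticAt ℝ K θ) (u v : Fin n → ℝ) :
    fderiv ℝ (pullbackForm c K) θ u v - fderiv ℝ (pullbackForm c K) θ v u
      = ((pjac c (K θ))ᵀ - pjac c (K θ)).mulVec (fderiv ℝ K θ v) ⬝ᵥ fderiv ℝ K θ u := by
  have hs := (hK.contDiffAt (n := 2)).isSymmSndFDerivAt (by simp)
  rw [fderiv_pullbackForm_apply hc hK, fderiv_pullbackForm_apply hc hK, hs.eq u v, sub_mulVec,
    sub_dotProduct, mulVec_transpose, ← dotProduct_mulVec, pjac_mulVec, pjac_mulVec,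
    dotProduct_comm (fderiv ℝ K θ v)]
  ring

end Pullback

/-- If `K` is a real analytic, `ℤⁿ`-periodic solution of the
invariant-torus equation with Diophantine `ω`, then the pull-back under `K` of the
1-form `c·dz` is `db + a₀·dθ`: there are a real analytic `ℤⁿ`-periodic `b : ℝⁿ → ℝ`
and a constant `a₀ ∈ ℝⁿ` with `DK(θ)ᵀ c(K(θ)) = ∇b(θ) + a₀` for all `θ`. -/
theorem stmt_8 {n : ℕ} (U : Set (Fin (2 * n) → ℝ)) (hU : IsOpen U)
    (B : (Fin (2 * n) → ℝ) → Matrix (Fin (2 * n)) (Fin (2 * n)) ℝ)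
    (hB : ∀ z ∈ U, ∀ i j, AnalyticAt ℝ (fun w => B w i j) z)
    (hskew : ∀ z ∈ U, ∀ i j, B z i j = - B z j i)
    (hjacobi : ∀ z ∈ U, ∀ i j k,
      ∑ l, (fderiv ℝ (fun w => B w i j) z (Pi.single l 1) * B z l k
          + fderiv ℝ (fun w => B w j k) z (Pi.single l 1) * B z l i
          + fderiv ℝ (fun w => B w k i) z (Pi.single l 1) * B z l j) = 0)
    (hBunit : ∀ z ∈ U, IsUnit (B z))
    (H : (Fin (2 * n) → ℝ) → ℝ) (hH : ∀ z ∈ U, AnalyticAt ℝ H z)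
    (c : (Fin (2 * n) → ℝ) → (Fin (2 * n) → ℝ)) (hc : ∀ z ∈ U, AnalyticAt ℝ c z)
    (hexact : ∀ z ∈ U, (B z)⁻¹ = (pjac c z)ᵀ - pjac c z)
    (γ σ : ℝ) (hγ : 0 < γ) (hσ : 0 < σ)
    (ω : Fin n → ℝ) (hω : IsDiophantine γ σ ω)
    (K : (Fin n → ℝ) → (Fin (2 * n) → ℝ)) (hK : ∀ θ, AnalyticAt ℝ K θ)
    (hKU : ∀ θ, K θ ∈ U)
    (hKper : ∀ (θ : Fin n → ℝ) (k : Fin n → ℤ), K (θ + fun i => (k i : ℝ)) = K θ)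
    (hsol : ∀ θ, fderiv ℝ K θ ω = (B (K θ)).mulVec (pgrad H (K θ))) :
    ∃ (b : (Fin n → ℝ) → ℝ) (a₀ : Fin n → ℝ),
      (∀ θ, AnalyticAt ℝ b θ) ∧
      (∀ (θ : Fin n → ℝ) (k : Fin n → ℤ), b (θ + fun i => (k i : ℝ)) = b θ) ∧
      (∀ θ, (pjac K θ)ᵀ.mulVec (c (K θ)) = pgrad b θ + a₀) := by
  have hnr : ∀ k : Fin n → ℤ, k ≠ 0 → ∑ i, (k i : ℝ) * ω i ≠ 0 := fun k hk =>
    hω.sum_mul_ne_zero hγ hk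
  have hα : ∀ θ, AnalyticAt ℝ (pullbackForm c K) θ := fun θ =>
    analyticAt_pullbackForm (hc _ (hKU θ)) (hK θ)
  have hHK : ∀ θ, AnalyticAt ℝ (fun θ => H (K θ)) θ := fun θ => (hH _ (hKU θ)).comp (hK θ)
  have hαω : ∀ θ, AnalyticAt ℝ (fun θ => pullbackForm c K θ ω) θ := fun θ =>
    ((ContinuousLinearMap.apply ℝ ℝ ω).analyticAt _).comp (hα θ)
  have hper : ∀ (θ : Fin n → ℝ) (k : Fin n → ℤ),
      pullbackForm c K (θ + fun i => (k i : ℝ)) = pullbackForm c K θ := fun θ k => by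
    have : fderiv ℝ K (θ + fun i => (k i : ℝ)) = fderiv ℝ K θ := by
      rw [← fderiv_comp_add_right]
      simp only [hKper]
    simp only [pullbackForm, this, hKper]
  have hf : ContDiff ℝ 2 fun θ => pullbackForm c K θ ω - H (K θ) :=
    contDiff_iff_contDiffAt.2 fun θ => ((hαω θ).sub (hHK θ)).contDiffAt
  have hdf : ∀ θ, fderiv ℝ (pullbackForm c K) θ ω
      = fderiv ℝ (fun θ => pullbackForm c K θ ω - H (K θ)) θ := by
    intro θ
    ext1 u
    have h1 := (hα θ).differentiableAt.hasFDerivAt.clm_apply (hasFDerivAt_const ω θ)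
    have h2 : HasFDerivAt (fun θ => H (K θ)) (fderiv ℝ H (K θ) ∘L fderiv ℝ K θ) θ :=
      (hH _ (hKU θ)).differentiableAt.hasFDerivAt.comp θ (hK θ).differentiableAt.hasFDerivAt
    have h3 := fderiv_pullbackForm_sub (hc _ (hKU θ)) (hK θ) u ω
    have hdet : IsUnit (B (K θ)).det := (isUnit_iff_isUnit_det _).1 (hBunit _ (hKU θ))
    rw [← hexact _ (hKU θ), hsol, mulVec_mulVec, nonsing_inv_mul _ hdet, one_mulVec,
      pgrad_dotProduct] at h3
    rw [(h1.fun_sub h2).fderiv]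
    simp
    linarith
  have hclosed := fderiv_symm_of_fderiv_apply_eq_fderiv
    (contDiff_iff_contDiffAt.2 fun θ => (hα θ).contDiffAt) hper hnr hf hdf
  obtain ⟨b, a₀, hb, hbper, hba⟩ :=
    exists_analytic_periodic_primitive_add_const hα hper hclosed
  refine ⟨b, a₀, hb, hbper, fun θ => funext fun i => ?_⟩
  have h := hba θ (Pi.single i 1)
  rw [pullbackForm_apply, ← pjac_mulVec, dotProduct_mulVec, ← mulVec_transpose] at h
  simpa [pgrad] using h
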